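/- The braid group B_n is Hopfian: every surjective group homomorphism from B_n to itself is injective (hence an isomorphism). -/

import Mathlib

/-- The set of Artin braid relations in the free group on `n - 1` generators:
`σᵢσⱼ = σⱼσᵢ` for `|i - j| > 1` and `σᵢσⱼσᵢ = σⱼσᵢσⱼ` for `|i - j| = 1`. -/
def braidRels (n : ℕ) : Set (FreeGroup (Fin (n - 1))) :=
  { r | (∃ i j : Fin (n - 1), (i : ℕ) + 1 < (j : ℕ) ∧
          r = FreeGroup.of i * FreeGroup.of j * (FreeGroup.of j * FreeGroup.of i)⁻¹) ∨
        (∃ i j : Fin (n - 1), (j : ℕ) = (i : ℕ) + 1 ∧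
          r = FreeGroup.of i * FreeGroup.of j * FreeGroup.of i *
              (FreeGroup.of j * FreeGroup.of i * FreeGroup.of j)⁻¹) }

/-- The braid group on `n` strands, via the Artin presentation. -/
abbrev BraidGroup (n : ℕ) : Type := PresentedGroup (braidRels n)

/-- The standard Artin generator `σᵢ` (`0`-indexed: `i = 0, …, n - 2`). -/
def braidGen (n : ℕ) (i : Fin (n - 1)) : BraidGroup n := PresentedGroup.of i


namespace BraidHopf

/-- Residual finiteness: nontrivial elements survive in a finite group. -/
def RF (G : Type) [Group G] : Prop :=
  ∀ g : G, g ≠ 1 → ∃ (Q : Type) (_ : Group Q) (_ : Finite Q) (f : G →* Q), f g ≠ 1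

theorem freeGroup_RF (α : Type) [DecidableEq α] : RF (FreeGroup α) := by
  intro w hw
  have hred := FreeGroup.isReduced_toWord (x := w)
  obtain ⟨L, hL⟩ : ∃ L, L = w.toWord := ⟨_, rfl⟩
  rw [← hL] at hred
  have hpos : 0 < L.length := by
    rw [List.length_pos_iff, hL]
    simpa using hw
  have hadj : ∀ i (h : i + 1 < L.length), L[i].1 = L[i+1].1 → L[i].2 = L[i+1].2 := by
    intro i h
    exact (List.isChain_iff_getElem.mp hred) i h
  have key : ∀ a : α, ∃ g : Equiv.Perm (Fin (L.length + 1)),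
      ∀ i (h : i < L.length), (L[i] = (a, true) → g ⟨i+1, by omega⟩ = ⟨i, by omega⟩) ∧
        (L[i] = (a, false) → g ⟨i, by omega⟩ = ⟨i+1, by omega⟩) := by
    intro a
    let D1 : Fin (L.length + 1) → Prop := fun p => ∃ h : 0 < p.1, L[p.1 - 1]'(by omega) = (a, true)
    let D2 : Fin (L.length + 1) → Prop := fun p => ∃ h : p.1 < L.length, L[p.1] = (a, false)
    classical
    let f : Fin (L.length + 1) → Fin (L.length + 1) := fun p =>
      if h : D1 p then ⟨p.1 - 1, by omega⟩ else
      if h : D2 p then ⟨p.1 + 1, by obtain ⟨h, _⟩ := h; omega⟩ else p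
    have hf1 : ∀ p, D1 p → (f p).1 + 1 = p.1 := by
      intro p h
      obtain ⟨h0, _⟩ := id h
      simp only [f, dif_pos h]; omega
    have hD : ∀ p, D1 p → D2 p → False := by
      rintro ⟨p, hp⟩ ⟨h0, h1⟩ ⟨h2, h3⟩
      obtain ⟨p, rfl⟩ : ∃ q, p = q + 1 := ⟨p - 1, by simp at h0; omega⟩
      have := hadj p h2
      simp at h1 h3
      simp [h1, h3] at this
    have hf2 : ∀ p, D2 p → (f p).1 = p.1 + 1 := by
      intro p h
      have h' : ¬ D1 p := fun h' => hD p h' h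
      simp only [f, dif_neg h', dif_pos h]
    have hinj : Set.InjOn f {p | D1 p ∨ D2 p} := by
      have aux : ∀ p q, D1 p → D2 q → f p = f q → False := by
        intro p q hp hq h
        have e1 := hf1 p hp
        have e2 := hf2 q hq
        rw [h, e2] at e1
        obtain ⟨h0, h1⟩ := hp
        obtain ⟨h2, h3⟩ := hq
        have hlt : q.1 + 1 < L.length := by have := p.2; omega
        have := hadj q.1 hlt
        have h1' : L[q.1 + 1] = (a, true) := by rw [← h1]; congr 1; omega
        rw [h1', h3] at this
        simp at this
      rintro p (hp | hp) q (hq | hq) h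
      · have e1 := hf1 p hp
        have e2 := hf1 q hq
        rw [h] at e1
        exact Fin.ext (by omega)
      · exact (aux p q hp hq h).elim
      · exact (aux q p hq hp h.symm).elim
      · have e1 := hf2 p hp
        have e2 := hf2 q hq
        rw [h] at e1
        exact Fin.ext (by omega)
    obtain ⟨g, hg⟩ := Finset.exists_equiv_extend_of_card_eq (t := Finset.univ) (by simp)
      (s := Finset.univ.filter fun p => D1 p ∨ D2 p) (f := f) (Finset.subset_univ _)
      (by intro p hp q hq h; exact hinj (by simpa using hp) (by simpa using hq) h)
    refine ⟨g.trans (Equiv.subtypeUnivEquiv (by simp)), ?_⟩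
    intro i h
    constructor
    · intro hi
      have hd : D1 ⟨i+1, by omega⟩ := ⟨by simp, by simpa using hi⟩
      have := hg ⟨i+1, by omega⟩ (by simp [hd])
      have e := hf1 _ hd
      apply Fin.ext
      simp [this] 
      simpa using e
    · intro hi
      have hd : D2 ⟨i, by omega⟩ := ⟨h, by simpa using hi⟩
      have := hg ⟨i, by omega⟩ (by simp [hd])
      have e := hf2 _ hd
      apply Fin.ext
      simp [this] 
      simpa using e
  choose g hg using key
  refine ⟨Equiv.Perm (Fin (L.length + 1)), inferInstance, inferInstance, FreeGroup.lift g, ?_⟩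
  have step : ∀ k (hk : k ≤ L.length),
      FreeGroup.lift g (FreeGroup.mk (L.drop (L.length - k))) ⟨L.length, by omega⟩ =
        ⟨L.length - k, by omega⟩ := by
    intro k
    induction k with
    | zero => intro _; simp [← FreeGroup.one_eq_mk]
    | succ k ih =>
      intro hk
      have e : L.drop (L.length - (k+1)) =
          [L[L.length - (k+1)]] ++ L.drop (L.length - k) := by
        rw [List.drop_eq_getElem_cons (by omega)]
        have e' : L.length - (k+1) + 1 = L.length - k := by omega
        rw [e']; rfl
      rw [e, ← FreeGroup.mul_mk, map_mul, Equiv.Perm.mul_apply, ih (by omega)]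
      have := hg L[L.length - (k+1)].1 (L.length - (k+1)) (by omega)
      rcases hx : L[L.length - (k+1)] with ⟨a, b⟩
      rw [hx] at this
      have e3 : (⟨L.length - k, by omega⟩ : Fin (L.length + 1)) = ⟨L.length - (k+1) + 1, by omega⟩ :=
        Fin.ext (by simp; omega)
      rw [e3]
      cases b
      · have h2 := this.2 rfl
        simp only [FreeGroup.lift_mk, List.map_cons, List.map_nil, List.prod_cons, List.prod_nil, cond, mul_one]
        rw [← h2]; simp
      · have h2 := this.1 rfl
        simp only [FreeGroup.lift_mk, List.map_cons, List.map_nil, List.prod_cons, List.prod_nil, cond, mul_one]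
        exact h2
  have := step L.length le_rfl
  simp only [Nat.sub_self, List.drop_zero] at this
  have hmk : FreeGroup.mk L = w := by rw [hL, FreeGroup.mk_toWord]
  rw [hmk] at this
  intro h1
  rw [h1] at this
  have h3 := congrArg Fin.val this
  simp at h3
  rw [h3] at hpos
  simp at hpos

/-- Artin relations on `m` generators. -/
def brel (m : ℕ) : Set (FreeGroup (Fin m)) :=
  { r | (∃ i j : Fin m, (i : ℕ) + 1 < (j : ℕ) ∧
          r = FreeGroup.of i * FreeGroup.of j * (FreeGroup.of j * FreeGroup.of i)⁻¹) ∨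
        (∃ i j : Fin m, (j : ℕ) = (i : ℕ) + 1 ∧
          r = FreeGroup.of i * FreeGroup.of j * FreeGroup.of i *
              (FreeGroup.of j * FreeGroup.of i * FreeGroup.of j)⁻¹) }

/-- Braid group with `m` generators. -/
abbrev B (m : ℕ) : Type := PresentedGroup (brel m)

/-- A sequence satisfying the braid relations for indices below `m`. -/
structure IsBraid {G : Type} [Group G] (m : ℕ) (s : ℕ → G) : Prop where
  comm : ∀ i j, i + 1 < j → j < m → s i * s j = s j * s i
  braid : ∀ i, i + 1 < m → s i * s (i+1) * s i = s (i+1) * s i * s (i+1)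

/-- The generators of `B m`, indexed by all naturals. -/
def sg (m : ℕ) (i : ℕ) : B m := if h : i < m then PresentedGroup.of ⟨i, h⟩ else 1

theorem sg_ge {m i : ℕ} (h : m ≤ i) : sg m i = 1 := dif_neg (by omega)

theorem sg_lt {m i : ℕ} (h : i < m) : sg m i = PresentedGroup.of ⟨i, h⟩ := dif_pos h

theorem isBraid_sg (m : ℕ) : IsBraid m (sg m) where
  comm i j h hj := by
    rw [sg_lt hj, sg_lt (show i < m by omega), ← mul_inv_eq_one]
    exact PresentedGroup.one_of_mem (rels := brel m)
      (Or.inl ⟨⟨i, by omega⟩, ⟨j, hj⟩, h, rfl⟩)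
  braid i h := by
    rw [sg_lt h, sg_lt (show i < m by omega), ← mul_inv_eq_one]
    exact PresentedGroup.one_of_mem (rels := brel m)
      (Or.inr ⟨⟨i, by omega⟩, ⟨i+1, h⟩, rfl, rfl⟩)

/-- Universal property of `B m`. -/
def bl {G : Type} [Group G] {m : ℕ} {s : ℕ → G} (h : IsBraid m s) : B m →* G :=
  PresentedGroup.toGroup (f := fun i : Fin m => s i) (by
    rintro r (⟨i, j, hij, rfl⟩ | ⟨i, j, hij, rfl⟩)
    · simp only [map_mul, map_inv, FreeGroup.lift_apply_of, mul_inv_eq_one]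
      exact h.comm i j hij j.2
    · simp only [map_mul, map_inv, FreeGroup.lift_apply_of, mul_inv_eq_one]
      rw [hij]
      exact h.braid i (by rw [← hij]; exact j.2))

theorem bl_sg {G : Type} [Group G] {m : ℕ} {s : ℕ → G} (h : IsBraid m s) {i : ℕ} (hi : i < m) :
    bl h (sg m i) = s i := by
  rw [sg_lt hi]; exact PresentedGroup.toGroup.of _

theorem B_induction {m : ℕ} (H : Subgroup (B m)) (h : ∀ i, i < m → sg m i ∈ H) (b : B m) : b ∈ H := by
  apply PresentedGroup.generated_by
  intro j
  have := h j.1 j.2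
  rwa [sg_lt j.2] at this

theorem B_equivariant {m : ℕ} {X Y : Type} (ρ : B m →* Equiv.Perm X) (τ : B m →* Equiv.Perm Y)
    (θ : X → Y) (h : ∀ i, i < m → ∀ p, θ (ρ (sg m i) p) = τ (sg m i) (θ p)) (b : B m) (p : X) :
    θ (ρ b p) = τ b (θ p) := by
  let H : Subgroup (B m) :=
    { carrier := {b | ∀ p, θ (ρ b p) = τ b (θ p)}
      one_mem' := by simp
      mul_mem' := by
        intro a b ha hb p
        simp only [Set.mem_ofPred_eq] at ha hb
        simp [ha, hb]
      inv_mem' := by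
        intro a ha p
        simp only [Set.mem_ofPred_eq] at ha
        have := ha ((ρ a)⁻¹ p)
        rw [map_inv, map_inv, Equiv.Perm.eq_inv_iff_eq, ← this]
        simp }
  exact B_induction H h b p

/-- The relations of the semidirect product of a free group by a braid group. -/
structure IsRel {G : Type} [Group G] (m : ℕ) (s x : ℕ → G) : Prop extends IsBraid m s where
  r1 : ∀ i, i < m → s i * x (i+1) = x i * s i
  r2 : ∀ i, i < m → s i * (x (i+1) * x i) = x (i+1) * x i * s i
  r3 : ∀ i k, i < m → k ≠ i → k ≠ i + 1 → s i * x k = x k * s i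

theorem IsRel.map {G H : Type} [Group G] [Group H] {m : ℕ} {s x : ℕ → G} (h : IsRel m s x)
    (f : G →* H) : IsRel m (fun i => f (s i)) (fun i => f (x i)) where
  comm i j h1 h2 := by simp only [← map_mul, h.comm i j h1 h2]
  braid i h1 := by simp only [← map_mul, h.braid i h1]
  r1 i h1 := by simp only [← map_mul, h.r1 i h1]
  r2 i h1 := by simp only [← map_mul, h.r2 i h1]
  r3 i k h1 h2 h3 := by simp only [← map_mul, h.r3 i k h1 h2 h3]

section wreath
variable {Q : Type} [Group Q] {m : ℕ} (s x : ℕ → Q)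

/-- The cocycle. -/
def coc (i j : ℕ) : Q :=
  if i + 1 < j then s i else if i + 1 = j then 1 else if i = j then x j else s (i - 1)

/-- The monomial permutation attached to `σ i`. -/
def T (m : ℕ) (i : ℕ) : Equiv.Perm (Fin (m + 2) × Q) :=
  if h : i < m + 1 then
    Equiv.prodShear (Equiv.swap ⟨i, by omega⟩ ⟨i+1, by omega⟩) (fun j => Equiv.mulLeft (coc s x i j))
  else 1

theorem T_gt {i j : ℕ} (h : i + 1 < j) (hj : j < m + 2) (q : Q) :
    T s x m i (⟨j, hj⟩, q) = (⟨j, hj⟩, s i * q) := by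
  have hi : i < m + 1 := by omega
  simp only [T, dif_pos hi, Equiv.prodShear_apply, coc]
  rw [Equiv.swap_apply_of_ne_of_ne (by simp; omega) (by simp; omega)]
  simp [h]

theorem T_succ {i : ℕ} (hj : i + 1 < m + 2) (q : Q) :
    T s x m i (⟨i+1, hj⟩, q) = (⟨i, by omega⟩, q) := by
  have hi : i < m + 1 := by omega
  simp only [T, dif_pos hi, Equiv.prodShear_apply, coc]
  rw [Equiv.swap_apply_right]
  simp

theorem T_self {i : ℕ} (hi : i < m + 1) (hi' : i < m + 2) (q : Q) :
    T s x m i (⟨i, hi'⟩, q) = (⟨i + 1, by omega⟩, x i * q) := by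
  simp only [T, dif_pos hi, Equiv.prodShear_apply, coc]
  rw [Equiv.swap_apply_left]
  simp

theorem T_lt {i j : ℕ} (hi : i + 1 < m + 1) (h : j < i + 1) (hj : j < m + 2) (q : Q) :
    T s x m (i + 1) (⟨j, hj⟩, q) = (⟨j, hj⟩, s i * q) := by
  simp only [T, dif_pos hi, Equiv.prodShear_apply, coc]
  rw [Equiv.swap_apply_of_ne_of_ne (by simp; omega) (by simp; omega)]
  rw [if_neg (by omega), if_neg (by omega), if_neg (by omega)]
  simp

variable {s x}
theorem isBraid_T (h : IsRel m s x) : IsBraid (m + 1) (T s x m) where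
  comm i k hik hk := by
    obtain ⟨k, rfl⟩ : ∃ k', k = k' + 1 := ⟨k - 1, by omega⟩
    ext1 ⟨⟨j, hj⟩, q⟩
    simp only [Equiv.Perm.mul_apply]
    rcases lt_trichotomy j i with hji | rfl | hji
    · obtain ⟨i, rfl⟩ : ∃ i', i = i' + 1 := ⟨i - 1, by omega⟩
      simp (disch := omega) only [T_lt]
      rw [← mul_assoc, ← mul_assoc, h.comm i k (by omega) (by omega)]
    · simp (disch := omega) only [T_lt, T_self]
      rw [← mul_assoc, ← mul_assoc, h.r3 k j (by omega) (by omega) (by omega)]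
    rcases Nat.lt_or_ge (i + 1) j with hj1 | hj1
    swap
    · obtain rfl : j = i + 1 := by omega
      simp (disch := omega) only [T_lt, T_succ]
    rcases lt_trichotomy j (k + 1) with hjk | rfl | hjk
    · simp (disch := omega) only [T_lt, T_gt]
      rw [← mul_assoc, ← mul_assoc, h.comm i k (by omega) (by omega)]
    · simp (disch := omega) only [T_self, T_gt]
      rw [← mul_assoc, ← mul_assoc, h.r3 i (k+1) (by omega) (by omega) (by omega)]
    rcases Nat.lt_or_ge (k + 2) j with hj1 | hj1
    · simp (disch := omega) only [T_gt]
      rw [← mul_assoc, ← mul_assoc, h.comm i (k+1) (by omega) (by omega)]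
    · obtain rfl : j = k + 1 + 1 := by omega
      simp (disch := omega) only [T_succ, T_gt]
  braid i hi := by
    ext1 ⟨⟨j, hj⟩, q⟩
    simp only [Equiv.Perm.mul_apply]
    rcases lt_trichotomy j i with hji | rfl | hji
    · obtain ⟨i, rfl⟩ : ∃ i', i = i' + 1 := ⟨i - 1, by omega⟩
      have := congrArg (· * q) (h.braid i (by omega))
      simp only [mul_assoc] at this
      simp (disch := omega) only [T_lt]
      rw [this]
    · have := congrArg (· * q) (h.r2 j (by omega))
      simp only [mul_assoc] at this
      simp (disch := omega) only [T_lt, T_self, T_gt]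
      rw [this]
    rcases Nat.lt_or_ge (i + 1) j with hj1 | hj1
    swap
    · obtain rfl : j = i + 1 := by omega
      have := congrArg (· * q) (h.r1 i (by omega))
      simp only [mul_assoc] at this
      simp (disch := omega) only [T_lt, T_self, T_gt, T_succ]
      rw [this]
    rcases Nat.lt_or_ge (i + 2) j with hj1 | hj1
    · have := congrArg (· * q) (h.braid i (by omega))
      simp only [mul_assoc] at this
      simp (disch := omega) only [T_gt]
      rw [this]
    · obtain rfl : j = i + 1 + 1 := by omega
      simp (disch := omega) only [T_lt, T_gt, T_succ]

theorem T_map {Q' : Type} [Group Q'] (f : Q →* Q') {i : ℕ} (hi : i < m + 1)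
    (p : Fin (m + 2) × Q) :
    Prod.map id f (T s x m i p) =
      T (fun i => f (s i)) (fun i => f (x i)) m i (Prod.map id f p) := by
  obtain ⟨⟨j, hj⟩, q⟩ := p
  simp only [Prod.map_apply, id]
  rcases lt_trichotomy j i with hji | rfl | hji
  · obtain ⟨i, rfl⟩ : ∃ i', i = i' + 1 := ⟨i - 1, by omega⟩
    rw [T_lt _ _ (by omega) (by omega), T_lt _ _ (by omega) (by omega)]; simp
  · rw [T_self _ _ (by omega), T_self _ _ (by omega)]; simp
  rcases Nat.lt_or_ge (i + 1) j with hj1 | hj1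
  · rw [T_gt _ _ (by omega), T_gt _ _ (by omega)]; simp
  · obtain rfl : j = i + 1 := by omega
    rw [T_succ, T_succ]; simp

end wreath
section staircase
variable {K : Type} [Group K] (s : ℕ → K) (m : ℕ)

/-- The coset representative `σ_j ⋯ σ_m`. -/
def rr (j : ℕ) : K := if j ≤ m then s j * rr (j + 1) else 1
termination_by m + 1 - j

/-- The image of the free generator. -/
def aa (k : ℕ) : K := (rr s m (k + 1))⁻¹ * (s k * rr s m k)

variable {s m}

theorem rr_le {j : ℕ} (h : j ≤ m) : rr s m j = s j * rr s m (j + 1) := by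
  rw [rr, if_pos h]

theorem rr_gt {j : ℕ} (h : m < j) : rr s m j = 1 := by
  rw [rr, if_neg (by omega)]

theorem rr_comm (hs : IsBraid (m + 1) s) {i : ℕ} (d j : ℕ) (hd : m + 1 - j = d) (hij : i + 1 < j) :
    s i * rr s m j = rr s m j * s i := by
  induction d generalizing j with
  | zero => rw [rr_gt (by omega)]; simp
  | succ d ih =>
    rw [rr_le (by omega), ← mul_assoc, hs.comm i j hij (by omega), mul_assoc,
      ih (j + 1) (by omega) (by omega), mul_assoc]

theorem rr_shift (hs : IsBraid (m + 1) s) {i : ℕ} (hi : i < m) (d j : ℕ) (hd : i - j = d)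
    (hij : j ≤ i) : s (i + 1) * rr s m j = rr s m j * s i := by
  induction d generalizing j with
  | zero =>
    obtain rfl : j = i := by omega
    have h := hs.braid j (by omega)
    have h2 := rr_comm hs (i := j) _ (j + 1 + 1) rfl (by omega)
    rw [rr_le (by omega), rr_le (show j + 1 ≤ m by omega)]
    calc s (j+1) * (s j * (s (j+1) * rr s m (j+1+1)))
        = (s (j+1) * s j * s (j+1)) * rr s m (j+1+1) := by simp only [mul_assoc]
      _ = s j * s (j+1) * (s j * rr s m (j+1+1)) := by rw [← h]; simp only [mul_assoc]
      _ = _ := by rw [h2]; simp only [mul_assoc]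
  | succ d ih =>
    rw [rr_le (by omega), ← mul_assoc, ← hs.comm j (i+1) (by omega) (by omega), mul_assoc,
      ih (j + 1) (by omega) (by omega), mul_assoc]

theorem conj_aux {a b : K} (h : a * b * a = b * a * b) :
    b⁻¹ * (a * a) * b = a * (b * b) * a⁻¹ := by
  have h1 : b⁻¹ * a * b = a * b * a⁻¹ := by
    rw [eq_mul_inv_iff_mul_eq, mul_assoc, mul_assoc, inv_mul_eq_iff_eq_mul]
    simpa only [mul_assoc] using h
  calc b⁻¹ * (a * a) * b = (b⁻¹ * a * b) * (b⁻¹ * a * b) := by group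
    _ = _ := by rw [h1]; group

theorem isRel_aa (hs : IsBraid (m + 1) s) (h1 : ∀ k, m < k → s k = 1) : IsRel m s (aa s m) := by
  have e1 : ∀ i, i < m → aa s m (i+1) =
      (rr s m (i+1+1))⁻¹ * (s (i+1) * s (i+1)) * rr s m (i+1+1) := by
    intro i hi
    rw [aa, rr_le (show i + 1 ≤ m by omega)]; simp only [mul_assoc]
  have e0 : ∀ i, i < m → aa s m i =
      (rr s m (i+1+1))⁻¹ * (s i * (s (i+1) * s (i+1)) * (s i)⁻¹) * rr s m (i+1+1) := by
    intro i hi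
    rw [← conj_aux (hs.braid i (by omega)), aa, rr_le (show i ≤ m by omega),
      rr_le (show i + 1 ≤ m by omega)]
    simp only [mul_assoc, mul_inv_rev]
  have hc : ∀ i, (s i)⁻¹ * rr s m (i+1+1) = rr s m (i+1+1) * (s i)⁻¹ := by
    intro i
    have := rr_comm hs (i := i) _ (i + 1 + 1) rfl (by omega)
    exact (Commute.inv_left this)
  have e2 : ∀ i, i < m → aa s m i = s i * aa s m (i+1) * (s i)⁻¹ := by
    intro i hi
    have h2 : (rr s m (i+1+1))⁻¹ * s i = s i * (rr s m (i+1+1))⁻¹ := by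
      have : Commute (s i) (rr s m (i+1+1)) := rr_comm hs (i := i) _ (i + 1 + 1) rfl (by omega)
      exact this.inv_right.symm
    rw [e0 i hi, e1 i hi]
    calc _ = ((rr s m (i+1+1))⁻¹ * s i) * (s (i+1) * s (i+1)) * ((s i)⁻¹ * rr s m (i+1+1)) := by
            simp only [mul_assoc]
      _ = _ := by rw [h2, hc i]; simp only [mul_assoc]
  refine ⟨⟨fun i j h h' => hs.comm i j h (by omega), fun i h => hs.braid i (by omega)⟩, ?_, ?_, ?_⟩
  · intro i hi
    rw [e2 i hi]; group
  · intro i hi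
    have h2 : Commute (s i) (rr s m (i+1+1)) := rr_comm hs (i := i) _ (i + 1 + 1) rfl (by omega)
    have hb := hs.braid i (by omega)
    have hprod : aa s m (i+1) * aa s m i =
        (rr s m (i+1+1))⁻¹ * (s (i+1) * (s i * s i) * s (i+1)) * rr s m (i+1+1) := by
      rw [e1 i hi, e0 i hi, ← conj_aux hb]; group
    have h3 : Commute (s i) (s (i+1) * (s i * s i) * s (i+1)) := by
      have hb' : s i * (s (i+1) * s i) = s (i+1) * (s i * s (i+1)) := by
        simpa only [mul_assoc] using hb
      show s i * (s (i+1) * (s i * s i) * s (i+1)) = (s (i+1) * (s i * s i) * s (i+1)) * s i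
      calc _ = (s i * s (i+1) * s i) * (s i * s (i+1)) := by simp only [mul_assoc]
        _ = s (i+1) * s i * (s (i+1) * (s i * s (i+1))) := by rw [hb]; simp only [mul_assoc]
        _ = _ := by rw [← hb']; simp only [mul_assoc]
    rw [hprod]
    exact (h2.inv_right.mul_right h3).mul_right h2
  · intro i k hi hk hk'
    rcases Nat.lt_or_ge k i with hki | hki
    · obtain ⟨d, rfl⟩ : ∃ d, i = d := ⟨i, rfl⟩
      have l1 := rr_shift hs hi _ k rfl (by omega)
      have l2 := rr_shift hs hi _ (k+1) rfl (by omega)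
      have l3 := hs.comm k (i+1) (by omega) (by omega)
      have l2' : s i * (rr s m (k+1))⁻¹ = (rr s m (k+1))⁻¹ * s (i+1) := by
        rw [mul_inv_eq_iff_eq_mul, mul_assoc, l2]; group
      rw [aa, ← mul_assoc, l2', mul_assoc, ← mul_assoc (s (i+1)), ← l3, mul_assoc, l1]
      simp only [mul_assoc]
    · have c1 : Commute (s i) (rr s m k) := rr_comm hs (i := i) _ k rfl (by omega)
      have c2 : Commute (s i) (rr s m (k+1)) := rr_comm hs (i := i) _ (k+1) rfl (by omega)
      have c3 : Commute (s i) (s k) := by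
        rcases Nat.lt_or_ge m k with hmk | hmk
        · rw [h1 k hmk]; exact Commute.one_right _
        · exact hs.comm i k (by omega) (by omega)
      exact c2.inv_right.mul_right (c3.mul_right c1)

end staircase

section artin
open FreeGroup (of lift lift_apply_of)

/-- Artin action on generators. -/
def fwd (i k : ℕ) : FreeGroup ℕ :=
  if k = i then (of i)⁻¹ * of (i+1) * of i else if k = i + 1 then of i else of k

/-- Inverse Artin action on generators. -/
def bwd (i k : ℕ) : FreeGroup ℕ :=
  if k = i then of (i+1) else if k = i + 1 then of (i+1) * of i * (of (i+1))⁻¹ else of k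

theorem fwd_self (i : ℕ) : fwd i i = (of i)⁻¹ * of (i+1) * of i := if_pos rfl
theorem fwd_succ (i : ℕ) : fwd i (i+1) = of i := by simp [fwd]
theorem fwd_ne {i k : ℕ} (h : k ≠ i) (h' : k ≠ i + 1) : fwd i k = of k := by simp [fwd, h, h']
theorem bwd_self (i : ℕ) : bwd i i = of (i+1) := if_pos rfl
theorem bwd_succ (i : ℕ) : bwd i (i+1) = of (i+1) * of i * (of (i+1))⁻¹ := by simp [bwd]
theorem bwd_ne {i k : ℕ} (h : k ≠ i) (h' : k ≠ i + 1) : bwd i k = of k := by simp [bwd, h, h']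

/-- The Artin automorphism. -/
def art (i : ℕ) : MulAut (FreeGroup ℕ) :=
  MonoidHom.toMulEquiv (lift (fwd i)) (lift (bwd i))
    (by
      ext k
      simp only [MonoidHom.comp_apply, lift_apply_of, MonoidHom.id_apply]
      by_cases h : k = i
      · subst h; simp [fwd_self, bwd_self, bwd_succ]; group
      by_cases h' : k = i + 1
      · subst h'; simp [fwd_succ, bwd_self]
      simp [fwd_ne h h', bwd_ne h h'])
    (by
      ext k
      simp only [MonoidHom.comp_apply, lift_apply_of, MonoidHom.id_apply]
      by_cases h : k = i
      · subst h; simp [fwd_succ, bwd_self]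
      by_cases h' : k = i + 1
      · subst h'; simp [fwd_succ, bwd_succ, fwd_self]; group
      simp [fwd_ne h h', bwd_ne h h'])

theorem art_of (i k : ℕ) : art i (of k) = fwd i k := by
  show lift (fwd i) (of k) = _
  exact lift_apply_of

theorem art_self (i : ℕ) : art i (of i) = (of i)⁻¹ * of (i+1) * of i := by rw [art_of, fwd_self]
theorem art_succ (i : ℕ) : art i (of (i+1)) = of i := by rw [art_of, fwd_succ]
theorem art_ne {i k : ℕ} (h : k ≠ i) (h' : k ≠ i + 1) : art i (of k) = of k := by
  rw [art_of, fwd_ne h h']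

theorem mulAut_ext {f g : MulAut (FreeGroup ℕ)} (h : ∀ k, f (of k) = g (of k)) : f = g := by
  have : f.toMonoidHom = g.toMonoidHom := by
    ext k; exact h k
  ext x
  exact DFunLike.congr_fun this x

theorem isBraid_art (m : ℕ) : IsBraid m art where
  comm i j h _ := by
    apply mulAut_ext
    intro k
    simp only [MulAut.mul_apply]
    by_cases h1 : k = i
    · subst h1
      simp (disch := omega) only [art_self, art_ne, map_mul, map_inv]
    by_cases h2 : k = i + 1
    · subst h2
      simp (disch := omega) only [art_succ, art_ne, map_mul, map_inv]
    by_cases h3 : k = j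
    · subst h3
      simp (disch := omega) only [art_self, art_ne, map_mul, map_inv]
    by_cases h4 : k = j + 1
    · subst h4
      simp (disch := omega) only [art_succ, art_ne, map_mul, map_inv]
    simp (disch := omega) only [art_ne]
  braid i _ := by
    apply mulAut_ext
    intro k
    simp only [MulAut.mul_apply]
    by_cases h1 : k = i
    · subst h1
      simp (disch := omega) only [art_self, art_succ, art_ne, map_mul, map_inv]
      group
    by_cases h2 : k = i + 1
    · subst h2
      simp (disch := omega) only [art_self, art_succ, art_ne, map_mul, map_inv]
    by_cases h3 : k = i + 1 + 1
    · subst h3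
      simp (disch := omega) only [art_self, art_succ, art_ne, map_mul, map_inv]
    simp (disch := omega) only [art_ne]

/-- The Artin action. -/
def act (m : ℕ) : B m →* MulAut (FreeGroup ℕ) := bl (isBraid_art m)

theorem act_sg {m i : ℕ} (h : i < m) : act m (sg m i) = art i := bl_sg _ h

theorem act_fix {m k : ℕ} (h : m < k) (b : B m) : act m b (of k) = of k := by
  let H : Subgroup (B m) :=
    { carrier := {b | act m b (of k) = of k}
      one_mem' := by simp
      mul_mem' := by
        intro a b ha hb
        simp only [Set.mem_ofPred_eq] at ha hb ⊢
        rw [map_mul, MulAut.mul_apply, hb, ha]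
      inv_mem' := by
        intro a ha
        simp only [Set.mem_ofPred_eq] at ha ⊢
        rw [map_inv]
        conv_lhs => rw [← ha]
        simp }
  apply B_induction H
  intro i hi
  show act m (sg m i) (of k) = of k
  rw [act_sg hi, art_ne (by omega) (by omega)]

/-- Free by braid. -/
abbrev GG (m : ℕ) : Type := FreeGroup ℕ ⋊[act m] B m

/-- Braid generators in `GG`. -/
def gs (m i : ℕ) : GG m := SemidirectProduct.inr (sg m i)

/-- Free generators in `GG`. -/
def gx (m k : ℕ) : GG m := SemidirectProduct.inl (of k)

theorem inr_inl {m i : ℕ} (hi : i < m) (n : FreeGroup ℕ) :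
    gs m i * SemidirectProduct.inl n = SemidirectProduct.inl (art i n) * gs m i := by
  rw [← act_sg hi, SemidirectProduct.inl_aut, gs]; simp

theorem isRel_GG (m : ℕ) : IsRel m (gs m) (gx m) where
  comm i j h h' := by simp only [gs, ← map_mul, (isBraid_sg m).comm i j h h']
  braid i h := by simp only [gs, ← map_mul, (isBraid_sg m).braid i h]
  r1 i h := by rw [gx, inr_inl h, art_succ, gx]
  r2 i h := by
    rw [gx, gx, ← map_mul, inr_inl h, map_mul, art_succ, art_self]; congr 2; group
  r3 i k h h1 h2 := by rw [gx, inr_inl h, art_ne h1 h2]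

/-- Universal property of `GG`. -/
def gl {K : Type} [Group K] {m : ℕ} {s x : ℕ → K} (h : IsRel m s x) : GG m →* K :=
  SemidirectProduct.lift (FreeGroup.lift x) (bl h.toIsBraid) (by
    intro b
    ext1 n
    have key := B_equivariant ((MulAut.toPerm (FreeGroup ℕ)).comp (act m))
      ((MulAut.toPerm K).comp (MulAut.conj.comp (bl h.toIsBraid))) (FreeGroup.lift x)
      (by
        intro i hi n
        simp only [MonoidHom.comp_apply, act_sg hi, bl_sg _ hi]
        show FreeGroup.lift x (art i n) = MulAut.conj (s i) (FreeGroup.lift x n)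
        have : (FreeGroup.lift x).comp (art i).toMonoidHom =
            (MulAut.conj (s i)).toMonoidHom.comp (FreeGroup.lift x) := by
          ext k
          show FreeGroup.lift x (art i (of k)) = MulAut.conj (s i) (FreeGroup.lift x (of k))
          rw [lift_apply_of, MulAut.conj_apply, eq_mul_inv_iff_mul_eq]
          by_cases h1 : k = i
          · subst h1
            rw [art_self]
            simp only [map_mul, map_inv, lift_apply_of]
            have e1 := h.r1 k hi
            have e2 := h.r2 k hi
            rw [← mul_assoc, e1] at e2
            rw [mul_assoc, mul_assoc, ← mul_assoc (x (k+1)), ← e2]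
            simp only [mul_assoc, inv_mul_cancel_left]
          by_cases h2 : k = i + 1
          · subst h2
            rw [art_succ, lift_apply_of, h.r1 i hi]
          rw [art_ne h1 h2, lift_apply_of, h.r3 i k hi h1 h2]
        exact DFunLike.congr_fun this n) b (of n)
    exact key)

theorem gl_gs {K : Type} [Group K] {m : ℕ} {s x : ℕ → K} (h : IsRel m s x) {i : ℕ} (hi : i < m) :
    gl h (gs m i) = s i := by
  rw [gl, gs, SemidirectProduct.lift_inr, bl_sg _ hi]

theorem gl_gx {K : Type} [Group K] {m : ℕ} {s x : ℕ → K} (h : IsRel m s x) {i : ℕ} :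
    gl h (gx m i) = x i := by
  rw [gl, gx, SemidirectProduct.lift_inl, lift_apply_of]

end artin

section RFsemi

/-- A semidirect product acts on (stable set of homs) × (finite group). -/
theorem semi_action {N H Q : Type} [Group N] [Group H] [Group Q] [Finite Q] (φ : H →* MulAut N)
    (S : Set (N →* Q)) (hS : S.Finite)
    (hst : ∀ h ∈ S, ∀ b, h.comp (φ b).toMonoidHom ∈ S) (h0 : N →* Q) (hh : h0 ∈ S) (f : N)
    (hf : h0 f ≠ 1) :
    ∃ (P : Type) (_ : Group P) (_ : Finite P) (F : N ⋊[φ] H →* P), F (SemidirectProduct.inl f) ≠ 1 := by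
  let X := S × Q
  have : Finite S := hS
  letI : MulAction (N ⋊[φ] H) X :=
    { smul := fun g p => (⟨p.1.1.comp (φ g.right⁻¹).toMonoidHom, hst _ p.1.2 _⟩,
        p.1.1 (φ g.right⁻¹ g.left) * p.2)
      one_smul := by
        rintro ⟨⟨h, hh⟩, q⟩
        refine Prod.ext (Subtype.ext ?_) ?_
        · ext n
          show h (φ (1 : N ⋊[φ] H).right⁻¹ n) = h n
          simp
        · show h (φ (1 : N ⋊[φ] H).right⁻¹ (1 : N ⋊[φ] H).left) * q = q
          simp
      mul_smul := by
        rintro g g' ⟨⟨h, hh⟩, q⟩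
        refine Prod.ext (Subtype.ext ?_) ?_
        · ext n
          show h (φ (g * g').right⁻¹ n) = h (φ g'.right⁻¹ (φ g.right⁻¹ n))
          simp
        · show h (φ (g * g').right⁻¹ (g * g').left) * q =
            h (φ g'.right⁻¹ (φ g.right⁻¹ g.left)) * (h (φ g'.right⁻¹ g'.left) * q)
          simp [mul_assoc] }
  refine ⟨Equiv.Perm X, inferInstance, inferInstance, MulAction.toPermHom _ X, ?_⟩
  intro h1
  have h2 := congrArg Prod.snd (DFunLike.congr_fun h1 ((⟨h0, hh⟩, 1) : X))
  apply hf
  have h3 : h0 (φ (SemidirectProduct.inl f : N ⋊[φ] H).right⁻¹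
    (SemidirectProduct.inl f : N ⋊[φ] H).left) * 1 = 1 := h2
  simpa using h3

theorem RF_GG (m : ℕ) (hB : RF (B m)) : RF (GG m) := by
  intro g hg
  by_cases hb : g.right = 1
  swap
  · obtain ⟨Q, i1, i2, f, hf⟩ := hB g.right hb
    exact ⟨Q, i1, i2, f.comp SemidirectProduct.rightHom, hf⟩
  obtain ⟨n, b⟩ := g
  simp only at hb
  subst hb
  have hn : n ≠ 1 := by
    rintro rfl; exact hg rfl
  obtain ⟨Q, i1, i2, h0, hf⟩ := freeGroup_RF ℕ n hn
  refine semi_action (act m) {h : FreeGroup ℕ →* Q | ∀ k, m < k → h (FreeGroup.of k) = h0 (FreeGroup.of k)}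
    ?_ ?_ h0 (fun _ _ => rfl) n hf
  · apply Set.Finite.of_injOn (f := fun (h : FreeGroup ℕ →* Q) (k : Fin (m+1)) => h (FreeGroup.of k))
      (t := Set.univ) (by intro _ _; trivial) ?_ (Set.finite_univ)
    intro h hh h' hh' e
    ext k
    rcases Nat.lt_or_ge m k with hk | hk
    · rw [hh k hk, hh' k hk]
    · exact congrFun e ⟨k, by omega⟩
  · intro h hh b k hk
    show h (act m b (FreeGroup.of k)) = _
    rw [act_fix hk]; exact hh k hk

end RFsemi

theorem RF_succ (m : ℕ) (hB : RF (B m)) : RF (B (m + 1)) := by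
  intro b hb
  have hs := isBraid_sg (m + 1)
  have hK : IsRel m (sg (m+1)) (aa (sg (m+1)) m) := isRel_aa hs (fun k hk => sg_ge (by omega))
  have hG := isRel_GG m
  let ψ := gl hK
  let ρ := bl (isBraid_T hG)
  let θ : Fin (m + 2) × GG m → B (m + 1) := fun p => rr (sg (m+1)) m p.1 * ψ p.2
  have hθ := B_equivariant ρ (MulAction.toPermHom (B (m+1)) (B (m+1))) θ (by
    rintro i hi ⟨⟨j, hj⟩, q⟩
    show θ (bl (isBraid_T hG) (sg (m+1) i) (⟨j, hj⟩, q)) =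
      sg (m+1) i * (rr (sg (m+1)) m j * ψ q)
    rw [bl_sg _ hi]
    rcases lt_trichotomy j i with hji | rfl | hji
    · obtain ⟨i, rfl⟩ : ∃ i', i = i' + 1 := ⟨i - 1, by omega⟩
      rw [T_lt _ _ (by omega) (by omega)]
      simp only [θ, map_mul]
      rw [gl_gs hK (by omega), ← mul_assoc, ← mul_assoc,
        rr_shift hs (by omega) _ j rfl (by omega)]
    · rw [T_self _ _ (by omega)]
      simp only [θ, map_mul]
      rw [gl_gx hK, aa]
      simp only [mul_assoc, mul_inv_cancel_left]
    rcases Nat.lt_or_ge (i + 1) j with hj1 | hj1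
    · rw [T_gt _ _ (by omega)]
      simp only [θ, map_mul]
      rw [gl_gs hK (by omega), ← mul_assoc, ← mul_assoc, rr_comm hs _ j rfl (by omega)]
    · obtain rfl : j = i + 1 := by omega
      rw [T_succ]
      simp only [θ]
      rw [rr_le (j := i) (by omega), mul_assoc]) b (Fin.last (m+1), 1)
  have hθ1 : θ (Fin.last (m+1), 1) = 1 := by
    simp [θ, rr_gt]
  have hne : ρ b (Fin.last (m+1), 1) ≠ (Fin.last (m+1), 1) := by
    intro h
    rw [h, hθ1] at hθ
    apply hb
    have : (1 : B (m+1)) = b * 1 := hθ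
    simpa using this.symm
  have main : ∀ (Q : Type) [Group Q] [Finite Q] (f : GG m →* Q),
      Prod.map id f (ρ b (Fin.last (m+1), 1)) ≠ (Fin.last (m+1), 1) →
      ∃ (Q : Type) (_ : Group Q) (_ : Finite Q) (f : B (m+1) →* Q), f b ≠ 1 := by
    intro Q _ _ f hf
    refine ⟨Equiv.Perm (Fin (m+2) × Q), inferInstance, inferInstance, bl (isBraid_T (hG.map f)), ?_⟩
    intro h1
    apply hf
    have := B_equivariant ρ (bl (isBraid_T (hG.map f))) (Prod.map id f) (by
      intro i hi p
      rw [bl_sg (isBraid_T (hG.map f)) hi]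
      show Prod.map id f (bl (isBraid_T hG) (sg (m+1) i) p) = _
      rw [bl_sg _ hi, T_map f hi]) b (Fin.last (m+1), 1)
    rw [this, h1]
    simp
  by_cases hg : (ρ b (Fin.last (m+1), 1)).2 = 1
  · apply main Unit 1
    intro h
    apply hne
    have h' : (ρ b (Fin.last (m+1), 1)).1 = Fin.last (m+1) := congrArg Prod.fst h
    exact Prod.ext h' hg
  · obtain ⟨Q, i1, i2, f, hf⟩ := RF_GG m hB _ hg
    apply main Q f
    intro h
    exact hf (congrArg Prod.snd h)

theorem RF_B (m : ℕ) : RF (B m) := by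
  induction m with
  | zero =>
    intro g hg
    exact absurd (Subgroup.mem_bot.mp (B_induction ⊥ (by intro i hi; omega) g)) hg
  | succ m ih => exact RF_succ m ih

theorem hopf (m : ℕ) (φ : B m →* B m) (hφ : Function.Surjective φ) : Function.Injective φ := by
  rw [injective_iff_map_eq_one]
  intro g hg
  by_contra hne
  obtain ⟨Q, i1, i2, f, hf⟩ := RF_B m g hne
  have : Finite (B m →* Q) := by
    apply Finite.of_injective (fun (h : B m →* Q) (k : Fin m) => h (PresentedGroup.of k))
    intro h h' e
    exact PresentedGroup.ext (fun k => congrFun e k)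
  have hinj : Function.Injective (fun h : B m →* Q => h.comp φ) := by
    intro h h' e
    ext1 k
    obtain ⟨y, hy⟩ := hφ (PresentedGroup.of k)
    rw [← hy]
    exact DFunLike.congr_fun e y
  obtain ⟨h, hh⟩ := Finite.surjective_of_injective hinj f
  apply hf
  rw [← hh]
  simp [hg]

end BraidHopf

/-- The braid group `Bₙ` is Hopfian: every surjective endomorphism is injective. -/
theorem braidGroup_hopfian (n : ℕ) (φ : BraidGroup n →* BraidGroup n)
    (hφ : Function.Surjective φ) : Function.Injective φ := by
  exact BraidHopf.hopf (n - 1) φ hφ
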